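/- arXiv:1402.0684 — 2 statements merged into one kernel-verified Lean document; each statement's English description precedes it below -/
import Mathlib

section
/- Let q ≥ 1 be an integer and η > 0. Then uniformly for real K, S, X ≥ 1 with S ≤ X·K^{-2}, one has Σ_{K < k ≤ 2K} Σ_{1 ≤ ℓ ≤ X/q} Σ_{1 ≤ v ≤ S, k²v − ℓq ≥ 1} d(k²v − ℓq) ≪_η (X/q)·(X^{1/2+η} + X·K^{-1}·(log 2X)³), where k, ℓ, v run over integers, d(n) is the number of divisors of n, and the implied constant depends only on η. -/
open scoped BigOperators

lemma aux_dmul (m n : ℕ) : (m * n).divisors.card ≤ m.divisors.card * n.divisors.card := by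
  rw [Nat.divisors_mul]; exact Finset.card_mul_le

lemma aux_dOmega (c : ℕ) (hc : c ≠ 0) : c.divisors.card ≤ 2 ^ (ArithmeticFunction.cardFactors c) := by
  induction c using induction_on_primes with
  | zero => exact absurd rfl hc
  | one => simp
  | prime_mul p a hp ih =>
    have ha : a ≠ 0 := by rintro rfl; simp at hc
    rw [ArithmeticFunction.cardFactors_mul hp.ne_zero ha,
      ArithmeticFunction.cardFactors_apply_prime hp, pow_add, pow_one]
    refine (aux_dmul p a).trans ?_
    rw [hp.divisors, Finset.card_pair hp.one_lt.ne]
    exact Nat.mul_le_mul_left _ (ih ha)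

lemma aux_Omega_pow (p c : ℕ) (hc : c ≠ 0) (h : ∀ r, r.Prime → r ∣ c → p ≤ r) :
    p ^ (ArithmeticFunction.cardFactors c) ≤ c := by
  induction c using induction_on_primes with
  | zero => exact absurd rfl hc
  | one => simp
  | prime_mul r a hr ih =>
    have ha : a ≠ 0 := by rintro rfl; simp at hc
    rw [ArithmeticFunction.cardFactors_mul hr.ne_zero ha,
      ArithmeticFunction.cardFactors_apply_prime hr, pow_add, pow_one]
    exact Nat.mul_le_mul (h r hr (dvd_mul_right _ _))
      (ih ha (fun s hs hsa => h s hs (hsa.mul_left _)))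

lemma aux_d_rough (p c t : ℕ) (hp : 2 ≤ p) (hc : c ≠ 0) (h : ∀ r, r.Prime → r ∣ c → p ≤ r)
    (hct : c ≤ p ^ t) : c.divisors.card ≤ 2 ^ t := by
  refine (aux_dOmega c hc).trans (Nat.pow_le_pow_right (by norm_num) ?_)
  exact (Nat.pow_le_pow_iff_right (by omega)).1 ((aux_Omega_pow p c hc h).trans hct)

/-- splitting at Z -/
lemma aux_split (Z : ℕ) (n : ℕ) (hZ : 1 ≤ Z) (hn : Z < n) :
    ∃ b p c : ℕ, n = b * (p * c) ∧ p.Prime ∧ 1 ≤ b ∧ b ≤ Z ∧ Z < b * p ∧ c ≠ 0 ∧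
      (∀ r, r.Prime → r ∣ b → r ≤ p) ∧ (∀ r, r.Prime → r ∣ p * c → p ≤ r) := by
  induction n using Nat.strong_induction_on with
  | _ n ih =>
    have hne : n.primeFactors.Nonempty := Nat.nonempty_primeFactors.2 (by omega)
    obtain ⟨P, hP, hmax⟩ := n.primeFactors.exists_max_image id hne
    have hPp := Nat.prime_of_mem_primeFactors hP
    obtain ⟨n', rfl⟩ := Nat.dvd_of_mem_primeFactors hP
    have hn0 : n' ≠ 0 := by rintro rfl; simp at hn
    have hmax' : ∀ r, r.Prime → r ∣ P * n' → r ≤ P := fun r hr hd =>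
      hmax r (Nat.mem_primeFactors.2 ⟨hr, hd, mul_ne_zero hPp.ne_zero hn0⟩)
    by_cases hle : n' ≤ Z
    · refine ⟨n', P, 1, by ring, hPp, by omega, hle, by rwa [mul_comm], one_ne_zero,
        fun r hr hd => hmax' r hr (hd.mul_left _), fun r hr hd => ?_⟩
      rw [mul_one] at hd
      exact ((Nat.prime_dvd_prime_iff_eq hr hPp).1 hd).ge
    · push Not at hle
      obtain ⟨b, p, c, h1, hp, hb, hbZ, hbp, hc, h2, h3⟩ :=
        ih n' (by nlinarith [hPp.two_le]) hle
      have hpP : p ≤ P := hmax' p hp (by rw [h1]; exact ⟨P * b * c, by ring⟩)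
      refine ⟨b, p, c * P, by rw [h1]; ring, hp, hb, hbZ, hbp, mul_ne_zero hc hPp.ne_zero, h2,
        fun r hr hd => ?_⟩
      rw [← mul_assoc] at hd
      rcases (hr.dvd_mul).1 hd with h | h
      · exact h3 r hr h
      · rw [(Nat.prime_dvd_prime_iff_eq hr hPp).1 h]; exact hpP

lemma aux_rankin (b : ℕ) (a : ℝ) :
    (b.divisors.card : ℝ) * (b : ℝ) ^ (a / 2) ≤ ∑ m ∈ b.divisors, (m : ℝ) ^ a := by
  have h1 : ∑ m ∈ b.divisors, ((b / m : ℕ) : ℝ) ^ a = ∑ m ∈ b.divisors, (m : ℝ) ^ a :=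
    Nat.sum_div_divisors b (fun m => (m : ℝ) ^ a)
  have h2 : ∑ m ∈ b.divisors, (2 * (b : ℝ) ^ (a / 2)) ≤
      ∑ m ∈ b.divisors, ((m : ℝ) ^ a + ((b / m : ℕ) : ℝ) ^ a) := by
    refine Finset.sum_le_sum fun m hm => ?_
    have hmb := Nat.dvd_of_mem_divisors hm
    have hm0 : 0 < m := Nat.pos_of_mem_divisors hm
    have e : (b : ℝ) = (m : ℝ) * ((b / m : ℕ) : ℝ) := by
      exact_mod_cast (Nat.mul_div_cancel' hmb).symm
    have h3 : (b : ℝ) ^ (a / 2) = (m : ℝ) ^ (a / 2) * ((b / m : ℕ) : ℝ) ^ (a / 2) := by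
      conv_lhs => rw [e]
      exact Real.mul_rpow (by positivity) (by positivity)
    have h4 : ∀ x : ℝ, 0 ≤ x → x ^ a = x ^ (a / 2) * x ^ (a / 2) := by
      intro x hx
      by_cases ha : a = 0
      · simp [ha]
      · rw [← Real.rpow_add' hx (by simpa using ha)]; congr 1; ring
    rw [h3, h4 m (by positivity), h4 ((b / m : ℕ) : ℝ) (by positivity)]
    nlinarith [sq_nonneg ((m : ℝ) ^ (a / 2) - ((b / m : ℕ) : ℝ) ^ (a / 2))]
  rw [Finset.sum_add_distrib, h1, Finset.sum_const, nsmul_eq_mul] at h2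
  linarith

lemma aux_mertens (n : ℕ) (hn : 1 ≤ n) :
    ∑ p ∈ n.primesLE, Real.log p / p ≤ Real.log n + Real.log 4 := by
  have hn' : (0 : ℝ) < n := by exact_mod_cast hn
  have h1 : ∑ p ∈ n.primesLE, ((n / p : ℕ) : ℝ) * Real.log p ≤ Real.log (n.factorial : ℝ) := by
    have hd : ∏ p ∈ n.primesLE, p ^ (n / p) ∣ n.factorial := by
      apply Finset.prod_dvd_of_isRelPrime
      · intro p hp r hr hpr
        exact Nat.coprime_iff_isRelPrime.1 (Nat.Coprime.pow _ _
          ((Nat.coprime_primes (Nat.prime_of_mem_primesLE hp)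
          (Nat.prime_of_mem_primesLE hr)).2 hpr))
      · intro p hp
        have hp' := Nat.prime_of_mem_primesLE hp
        rw [hp'.pow_dvd_iff_le_factorization (Nat.factorial_ne_zero n),
          Nat.factorization_factorial hp' (Nat.lt_succ_self _)]
        have : (n / p ^ 1) ≤ ∑ i ∈ Finset.Ico 1 (Nat.log p n).succ, n / p ^ i := by
          refine Finset.single_le_sum (f := fun i => n / p ^ i) (fun _ _ => Nat.zero_le _) ?_
          rw [Finset.mem_Ico]
          have := Nat.log_pos hp'.one_lt (Nat.le_of_mem_primesLE hp)
          omega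
        simpa using this
    have hle := Nat.le_of_dvd (Nat.factorial_pos n) hd
    have : Real.log ((∏ p ∈ n.primesLE, p ^ (n / p) : ℕ) : ℝ) ≤ Real.log (n.factorial : ℝ) := by
      apply Real.log_le_log
      · have : 0 < ∏ p ∈ n.primesLE, p ^ (n / p) :=
          Finset.prod_pos fun p hp => pow_pos (Nat.prime_of_mem_primesLE hp).pos _
        exact_mod_cast this
      · exact_mod_cast hle
    refine le_trans (le_of_eq ?_) this
    push_cast
    rw [Real.log_prod]
    · refine Finset.sum_congr rfl fun p hp => ?_
      rw [Real.log_pow]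
    · intro p hp
      have := (Nat.prime_of_mem_primesLE hp).pos
      positivity
  have h2 : Real.log (n.factorial : ℝ) ≤ n * Real.log n := by
    rw [← Real.log_pow]
    apply Real.log_le_log (by exact_mod_cast Nat.factorial_pos n)
    exact_mod_cast Nat.factorial_le_pow n
  have h3 : ∑ p ∈ n.primesLE, Real.log p ≤ Real.log 4 * n := by
    rw [← Chebyshev.theta_eq_sum_primesLE_log]
    exact Chebyshev.theta_le_log4_mul_x hn'.le
  have h4 : ∑ p ∈ n.primesLE, (n : ℝ) * (Real.log p / p) ≤
      ∑ p ∈ n.primesLE, (((n / p : ℕ) : ℝ) * Real.log p + Real.log p) := by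
    refine Finset.sum_le_sum fun p hp => ?_
    have hp' := Nat.prime_of_mem_primesLE hp
    have hl : 0 ≤ Real.log p := Real.log_natCast_nonneg p
    have : (n : ℝ) / p ≤ ((n / p : ℕ) : ℝ) + 1 := by
      rw [div_le_iff₀ (by exact_mod_cast hp'.pos)]
      have := Nat.lt_div_mul_add (a := n) hp'.pos
      have h5 : n ≤ (n / p + 1) * p := by rw [add_mul, one_mul]; omega
      exact_mod_cast h5
    calc (n : ℝ) * (Real.log p / p) = (n / p) * Real.log p := by ring
      _ ≤ (((n / p : ℕ) : ℝ) + 1) * Real.log p := by gcongr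
      _ = _ := by ring
  rw [← Finset.mul_sum, Finset.sum_add_distrib] at h4
  have h5 : (n : ℝ) * ∑ p ∈ n.primesLE, Real.log p / p ≤ n * (Real.log n + Real.log 4) := by
    linarith
  exact le_of_mul_le_mul_left h5 hn'

lemma aux_harm (n : ℕ) : ∑ m ∈ Finset.Icc 1 n, (1 : ℝ) / m ≤ 1 + Real.log n := by
  have := harmonic_le_one_add_log n
  rw [harmonic_eq_sum_Icc] at this
  push_cast at this
  simpa [one_div] using this

lemma aux_dbound (ε : ℝ) (hε : 0 < ε) : ∃ C : ℝ, 1 ≤ C ∧ ∀ n : ℕ, n ≠ 0 →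
    (n.divisors.card : ℝ) ≤ C * (n : ℝ) ^ ε := by
  set P0 : ℕ := ⌈(2 : ℝ) ^ (1 / ε)⌉₊ with hP0
  have hl2 : 0 < Real.log 2 := Real.log_pos (by norm_num)
  set c : ℝ := 1 + 1 / (ε * Real.log 2) with hc
  have hc1 : 1 ≤ c := by rw [hc]; have : 0 ≤ 1 / (ε * Real.log 2) := by positivity
                         linarith
  have hc2 : 1 ≤ c * (ε * Real.log 2) := by
    rw [hc, add_mul, one_div_mul_cancel (by positivity)]
    have : 0 < ε * Real.log 2 := by positivity
    linarith
  refine ⟨c ^ P0, one_le_pow₀ hc1, fun n hn => ?_⟩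
  have hnε : (n : ℝ) ^ ε = ∏ p ∈ n.primeFactors, ((p : ℝ) ^ ε) ^ (n.factorization p) := by
    conv_lhs => rw [← Nat.prod_factorization_pow_eq_self hn]
    rw [Finsupp.prod, Nat.support_factorization]
    push_cast
    rw [← Real.finsetProd_rpow _ _ (fun i _ => by positivity)]
    refine Finset.prod_congr rfl fun p _ => ?_
    rw [← Real.rpow_natCast, ← Real.rpow_natCast, ← Real.rpow_mul (by positivity),
      ← Real.rpow_mul (by positivity), mul_comm]
  have h1 : (n.divisors.card : ℝ) ≤ ∏ p ∈ n.primeFactors,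
      ((if p < P0 then c else 1) * ((p : ℝ) ^ ε) ^ (n.factorization p)) := by
    rw [Nat.card_divisors hn]
    push_cast
    refine Finset.prod_le_prod (fun _ _ => by positivity) fun p hp => ?_
    have hp' := Nat.prime_of_mem_primeFactors hp
    have hp2 : (2 : ℝ) ≤ p := by exact_mod_cast hp'.two_le
    generalize n.factorization p = a
    split_ifs with h
    · have h2 : 1 + ε * Real.log 2 ≤ (p : ℝ) ^ ε := by
        calc 1 + ε * Real.log 2 ≤ Real.exp (ε * Real.log 2) := by
              linarith [Real.add_one_le_exp (ε * Real.log 2)]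
          _ = (2 : ℝ) ^ ε := by rw [Real.rpow_def_of_pos (by norm_num), mul_comm]
          _ ≤ _ := Real.rpow_le_rpow (by norm_num) hp2 hε.le
      have hpos : 0 < ε * Real.log 2 := by positivity
      have h3 : 1 + (a : ℝ) * (ε * Real.log 2) ≤ ((p : ℝ) ^ ε) ^ a :=
        (one_add_mul_le_pow (by linarith) a).trans (by gcongr)
      have h4 : (a : ℝ) * 1 ≤ a * (c * (ε * Real.log 2)) := by gcongr
      calc (a : ℝ) + 1 ≤ c * (1 + (a : ℝ) * (ε * Real.log 2)) := by nlinarith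
        _ ≤ _ := by gcongr
    · have h2 : (2 : ℝ) ≤ (p : ℝ) ^ ε := by
        have : (2 : ℝ) ^ (1 / ε) ≤ p := (Nat.le_ceil _).trans (by exact_mod_cast not_lt.1 h)
        calc (2 : ℝ) = ((2 : ℝ) ^ (1 / ε)) ^ ε := by
              rw [← Real.rpow_mul (by norm_num), one_div_mul_cancel hε.ne', Real.rpow_one]
          _ ≤ _ := Real.rpow_le_rpow (by positivity) this hε.le
      rw [one_mul]
      calc (a : ℝ) + 1 ≤ 2 ^ a := by exact_mod_cast Nat.lt_two_pow_self
        _ ≤ _ := by gcongr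
  rw [Finset.prod_mul_distrib, ← hnε] at h1
  refine h1.trans ?_
  gcongr
  rw [← Finset.prod_filter, Finset.prod_const]
  refine pow_le_pow_right₀ hc1 ?_
  calc _ ≤ (Finset.range P0).card := Finset.card_le_card (fun p hp => by
        rw [Finset.mem_filter] at hp; exact Finset.mem_range.2 hp.2)
    _ = P0 := Finset.card_range _

lemma aux_sum_dvd (p N : ℕ) (hp : 0 < p) (h : ℕ → ℝ) :
    ∑ m ∈ (Finset.Icc 1 N).filter (fun m => p ∣ m), h m = ∑ m ∈ Finset.Icc 1 (N / p), h (p * m) := by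
  symm
  refine Finset.sum_bij (fun m _ => p * m) ?_ ?_ ?_ ?_
  · intro m hm
    rw [Finset.mem_Icc] at hm
    rw [Finset.mem_filter, Finset.mem_Icc]
    refine ⟨⟨Nat.mul_pos hp hm.1, ?_⟩, dvd_mul_right _ _⟩
    rw [mul_comm]; exact (Nat.le_div_iff_mul_le hp).1 hm.2
  · intro a _ b _ hab
    exact Nat.eq_of_mul_eq_mul_left hp hab
  · intro m hm
    rw [Finset.mem_filter, Finset.mem_Icc] at hm
    obtain ⟨⟨h1, h2⟩, r, rfl⟩ := hm
    refine ⟨r, ?_, rfl⟩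
    rw [Finset.mem_Icc]
    refine ⟨Nat.pos_of_mul_pos_left h1, ?_⟩
    rw [Nat.le_div_iff_mul_le hp, mul_comm]; exact h2
  · intros; rfl

lemma aux_step (p : ℕ) (hp : 2 ≤ p) (F G : ℕ → ℝ) (x δ : ℝ) (hF : ∀ m, 0 ≤ F m)
    (hδ : x * (1 + δ) - 1 ≤ p * δ) (hx : 0 ≤ x) (hδ0 : 0 ≤ δ)
    (hFp : ∀ m, 1 ≤ m → F (p * m) = F m)
    (hGp : ∀ m, 1 ≤ m → G (p * m) = x * G m) (hGF : ∀ m, ¬ p ∣ m → G m = F m) (N : ℕ) :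
    ∑ m ∈ Finset.Icc 1 N, G m / m ≤ (1 + δ) * ∑ m ∈ Finset.Icc 1 N, F m / m := by
  induction N using Nat.strong_induction_on with
  | _ N ih =>
    rcases Nat.eq_zero_or_pos N with rfl | hN
    · simp
    have ih' := ih (N / p) (Nat.div_lt_self hN (by omega))
    have hp0 : (0 : ℝ) < p := by exact_mod_cast (by omega : 0 < p)
    have eG := Finset.sum_filter_add_sum_filter_not (Finset.Icc 1 N) (fun m => p ∣ m) (fun m => G m / m)
    have eF := Finset.sum_filter_add_sum_filter_not (Finset.Icc 1 N) (fun m => p ∣ m) (fun m => F m / m)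
    rw [aux_sum_dvd p N (by omega)] at eG eF
    have e1 : ∑ m ∈ (Finset.Icc 1 N).filter (fun m => ¬ p ∣ m), G m / m =
        ∑ m ∈ (Finset.Icc 1 N).filter (fun m => ¬ p ∣ m), F m / m := by
      refine Finset.sum_congr rfl fun m hm => ?_
      rw [hGF m (Finset.mem_filter.1 hm).2]
    have e2 : ∑ m ∈ Finset.Icc 1 (N / p), G (p * m) / ((p * m : ℕ) : ℝ) =
        x / p * ∑ m ∈ Finset.Icc 1 (N / p), G m / m := by
      rw [Finset.mul_sum]
      refine Finset.sum_congr rfl fun m hm => ?_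
      rw [hGp m (Finset.mem_Icc.1 hm).1]; push_cast; rw [mul_div_mul_comm]
    have e3 : ∑ m ∈ Finset.Icc 1 (N / p), F (p * m) / ((p * m : ℕ) : ℝ) =
        1 / p * ∑ m ∈ Finset.Icc 1 (N / p), F m / m := by
      rw [Finset.mul_sum]
      refine Finset.sum_congr rfl fun m hm => ?_
      rw [hFp m (Finset.mem_Icc.1 hm).1]; push_cast; rw [div_mul_div_comm, one_mul]
    rw [← eG, ← eF, e1, e2, e3]
    set R := ∑ m ∈ (Finset.Icc 1 N).filter (fun m => ¬ p ∣ m), F m / m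
    set T := ∑ m ∈ Finset.Icc 1 (N / p), F m / m with hT
    have hR : 0 ≤ R := Finset.sum_nonneg fun m _ => div_nonneg (hF m) (by positivity)
    have hT0 : 0 ≤ T := Finset.sum_nonneg fun m _ => div_nonneg (hF m) (by positivity)
    -- T ≤ R + T/p
    have hTle : T ≤ 1 / p * T + R := by
      rw [← e3, eF]
      refine Finset.sum_le_sum_of_subset_of_nonneg
        (Finset.Icc_subset_Icc_right (Nat.div_le_self _ _))
        (fun m _ _ => div_nonneg (hF m) (by positivity))
    have h1 : x / p * ∑ m ∈ Finset.Icc 1 (N / p), G m / m ≤ x / p * ((1 + δ) * T) := by gcongr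
    have h2 : (x * (1 + δ) - 1) / p * T ≤ p * δ / p * T := by gcongr
    have h3 : p * δ / p = δ := by field_simp
    rw [h3] at h2
    have h4 : (x * (1 + δ) - 1) / p * T = x / p * ((1 + δ) * T) - 1 / p * T := by ring
    have h5 := mul_le_mul_of_nonneg_left hTle hδ0
    nlinarith

/-- `α`-weighted P-part -/
noncomputable def auxF (α : ℝ) (P : Finset ℕ) (m : ℕ) : ℝ :=
  ∏ p ∈ P, ((p : ℝ) ^ α) ^ (m.factorization p)

lemma aux_prod (α : ℝ) (hα0 : 0 ≤ α) (hα : α ≤ 1 / 4) (N : ℕ) (P : Finset ℕ)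
    (hP : ∀ p ∈ P, p.Prime) :
    ∑ m ∈ Finset.Icc 1 N, auxF α P m / m ≤
      (∏ p ∈ P, (1 + 4 * ((p : ℝ) ^ α - 1) / p)) * (1 + Real.log N) := by
  induction P using Finset.induction_on with
  | empty => simpa [auxF] using aux_harm N
  | insert p P hpP ih =>
    have hp := hP p (Finset.mem_insert_self _ _)
    have hp2 : (2 : ℝ) ≤ p := by exact_mod_cast hp.two_le
    have hx1 : 1 ≤ (p : ℝ) ^ α := Real.one_le_rpow (by linarith) hα0
    have hx2 : (p : ℝ) ^ α ≤ 3 / 4 * p := by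
      have h1 : (p : ℝ) ^ α ≤ (p : ℝ) ^ (1 / 4 : ℝ) :=
        Real.rpow_le_rpow_of_exponent_le (by linarith) hα
      have h2 : ((p : ℝ) ^ (1 / 4 : ℝ)) ^ 4 = p := by
        rw [← Real.rpow_natCast, ← Real.rpow_mul (by positivity)]; norm_num
      have h3 : (p : ℝ) ^ (1 / 4 : ℝ) ≤ 3 / 4 * p := by
        by_contra! hcon
        have : (3 / 4 * (p : ℝ)) ^ 4 < ((p : ℝ) ^ (1 / 4 : ℝ)) ^ 4 := by gcongr
        rw [h2] at this
        have h5 : (p : ℝ) ^ 3 ≥ 2 ^ 3 := by gcongr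
        nlinarith
      exact h1.trans h3
    have hδ0 : 0 ≤ 4 * ((p : ℝ) ^ α - 1) / p := by
      apply div_nonneg <;> linarith
    have hstep := aux_step p hp.two_le (auxF α P) (auxF α (insert p P)) ((p : ℝ) ^ α)
      (4 * ((p : ℝ) ^ α - 1) / p) (fun m => Finset.prod_nonneg fun _ _ => by positivity)
      (by
        have e : (p : ℝ) * (4 * ((p : ℝ) ^ α - 1) / p) = 4 * ((p : ℝ) ^ α - 1) := by
          field_simp
        set δ := 4 * ((p : ℝ) ^ α - 1) / p
        nlinarith) (by linarith) hδ0
      (by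
        intro m hm
        refine Finset.prod_congr rfl fun r hr => ?_
        rw [Nat.factorization_mul hp.ne_zero (by omega), hp.factorization]
        have : r ≠ p := fun h => hpP (h ▸ hr)
        simp [this.symm])
      (by
        intro m hm
        rw [auxF, auxF, Finset.prod_insert hpP, Finset.prod_insert hpP, ← mul_assoc]
        congr 1
        · rw [Nat.factorization_mul hp.ne_zero (by omega), hp.factorization]
          simp [pow_add]
        · refine Finset.prod_congr rfl fun r hr => ?_
          rw [Nat.factorization_mul hp.ne_zero (by omega), hp.factorization]
          have : r ≠ p := fun h => hpP (h ▸ hr)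
          simp [this.symm])
      (by
        intro m hm
        rw [auxF, Finset.prod_insert hpP, Nat.factorization_eq_zero_of_not_dvd hm, pow_zero,
          one_mul]; rfl) N
    rw [Finset.prod_insert hpP, mul_assoc]
    refine hstep.trans ?_
    gcongr
    exact ih fun r hr => hP r (Finset.mem_insert_of_mem hr)

lemma aux_smooth (α B : ℝ) (hα0 : 0 ≤ α) (hα : α ≤ 1 / 4) (Y N : ℕ) (hB : α * Real.log Y ≤ B) :
    ∑ m ∈ (Finset.Icc 1 N).filter (fun m => ∀ r ∈ m.primeFactors, r ≤ Y), (m : ℝ) ^ α / m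
      ≤ Real.exp (12 * B * Real.exp B) * (1 + Real.log N) := by
  have hB0 : 0 ≤ B := le_trans (mul_nonneg hα0 (Real.log_natCast_nonneg Y)) hB
  have hlN : 0 ≤ Real.log N := Real.log_natCast_nonneg N
  have h1 : ∑ m ∈ (Finset.Icc 1 N).filter (fun m => ∀ r ∈ m.primeFactors, r ≤ Y),
      (m : ℝ) ^ α / m ≤ ∑ m ∈ Finset.Icc 1 N, auxF α Y.primesLE m / m := by
    refine (Finset.sum_le_sum (f := fun m : ℕ => (m : ℝ) ^ α / m)
      (g := fun m => auxF α Y.primesLE m / m) fun m hm => ?_).trans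
      (Finset.sum_le_sum_of_subset_of_nonneg (Finset.filter_subset _ _) fun m _ _ =>
        div_nonneg (Finset.prod_nonneg fun _ _ => by positivity) (by positivity))
    rw [Finset.mem_filter, Finset.mem_Icc] at hm
    obtain ⟨⟨hm1, -⟩, hm2⟩ := hm
    have hm0 : m ≠ 0 := by omega
    have e : (m : ℝ) ^ α = auxF α Y.primesLE m := by
      have hsub : m.primeFactors ⊆ Y.primesLE := fun r hr => by
        rw [Nat.mem_primesLE]
        exact ⟨hm2 r hr,
          Nat.prime_of_mem_primeFactors hr⟩
      rw [auxF, ← Finset.prod_subset hsub]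
      · conv_lhs => rw [← Nat.prod_factorization_pow_eq_self hm0]
        rw [Finsupp.prod, Nat.support_factorization]
        push_cast
        rw [← Real.finsetProd_rpow _ _ (fun i _ => by positivity)]
        refine Finset.prod_congr rfl fun p _ => ?_
        rw [← Real.rpow_natCast, ← Real.rpow_natCast, ← Real.rpow_mul (by positivity),
          ← Real.rpow_mul (by positivity), mul_comm]
      · intro r _ hr
        rw [← Nat.support_factorization, Finsupp.notMem_support_iff] at hr
        rw [hr, pow_zero]
    rw [e]
  refine h1.trans ((aux_prod α hα0 hα N _ fun p hp => Nat.prime_of_mem_primesLE hp).trans ?_)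
  gcongr
  by_cases hY : Y < 2
  · have : Y.primesLE = ∅ := by
      ext p
      rw [Nat.mem_primesLE]
      simp only [Finset.notMem_empty, iff_false, not_and]
      intro h hp
      have := hp.two_le
      omega
    rw [this, Finset.prod_empty]
    exact Real.one_le_exp (by positivity)
  push Not at hY
  have h2 : ∏ p ∈ Y.primesLE, (1 + 4 * ((p : ℝ) ^ α - 1) / p) ≤
      ∏ p ∈ Y.primesLE, Real.exp (4 * ((p : ℝ) ^ α - 1) / p) := by
    refine Finset.prod_le_prod (fun p hp => ?_) fun p hp => ?_
    · have hp1 : (1 : ℝ) ≤ p := by exact_mod_cast (Nat.prime_of_mem_primesLE hp).one_lt.le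
      have := Real.one_le_rpow hp1 hα0
      have : 0 ≤ 4 * ((p : ℝ) ^ α - 1) / p := by apply div_nonneg <;> linarith
      linarith
    · linarith [Real.add_one_le_exp (4 * ((p : ℝ) ^ α - 1) / p)]
  refine h2.trans ?_
  rw [← Real.exp_sum]
  apply Real.exp_le_exp.2
  have h3 : ∑ p ∈ Y.primesLE, 4 * ((p : ℝ) ^ α - 1) / p ≤
      ∑ p ∈ Y.primesLE, (4 * α * Real.exp B) * (Real.log p / p) := by
    refine Finset.sum_le_sum fun p hp => ?_
    have hp0 : (0 : ℝ) < p := by exact_mod_cast (Nat.prime_of_mem_primesLE hp).pos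
    have hpY : (p : ℝ) ≤ Y := by exact_mod_cast Nat.le_of_mem_primesLE hp
    have hlp : Real.log p ≤ Real.log Y := Real.log_le_log hp0 hpY
    have hlp0 : 0 ≤ Real.log p := Real.log_natCast_nonneg p
    have e : (p : ℝ) ^ α = Real.exp (α * Real.log p) := by
      rw [Real.rpow_def_of_pos hp0, mul_comm]
    set t := α * Real.log p with ht
    have htB : t ≤ B := le_trans (by rw [ht]; gcongr) hB
    have ht0 : 0 ≤ t := by rw [ht]; positivity
    have h5 : Real.exp t - 1 ≤ t * Real.exp B := by
      have h6 : 1 - t ≤ Real.exp (-t) := by linarith [Real.add_one_le_exp (-t)]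
      have h7 : Real.exp t * Real.exp (-t) = 1 := by rw [← Real.exp_add]; simp
      have h8 : Real.exp t - 1 ≤ t * Real.exp t := by
        nlinarith [Real.exp_pos t]
      exact h8.trans (by gcongr)
    rw [e]
    calc 4 * (Real.exp t - 1) / p ≤ 4 * (t * Real.exp B) / p := by gcongr
      _ = _ := by rw [ht]; ring
  refine h3.trans ?_
  rw [← Finset.mul_sum]
  have h4 := aux_mertens Y (by omega)
  have h5 : Real.log 4 ≤ 2 * Real.log Y := by
    have : Real.log 4 = 2 * Real.log 2 := by
      rw [show (4 : ℝ) = 2 ^ 2 by norm_num, Real.log_pow]; norm_num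
    rw [this]
    have : Real.log 2 ≤ Real.log Y := Real.log_le_log (by norm_num) (by exact_mod_cast hY)
    linarith
  calc (4 * α * Real.exp B) * ∑ p ∈ Y.primesLE, Real.log p / p
      ≤ (4 * α * Real.exp B) * (3 * Real.log Y) := by gcongr; linarith
    _ = 12 * (α * Real.log Y) * Real.exp B := by ring
    _ ≤ _ := by gcongr

noncomputable def auxS (α : ℝ) (Y m : ℕ) : ℝ :=
  if ∀ r ∈ m.primeFactors, r ≤ Y then (m : ℝ) ^ α else 0

lemma auxS_nonneg (α : ℝ) (Y m : ℕ) : 0 ≤ auxS α Y m := by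
  unfold auxS; split_ifs <;> positivity

lemma aux_pt (α : ℝ) (hα : 0 ≤ α) (Y Z b n : ℕ) (hb1 : 1 ≤ b) (hb : b ∣ n) (hbZ : b ≤ Z) (hb2 : Z < b ^ 2)
    (hs : ∀ r, r.Prime → r ∣ b → r ≤ Y) :
    (Z : ℝ) ^ (α / 4) * (b.divisors.card : ℝ) ≤
      ∑ m ∈ (Finset.Icc 1 Z).filter (fun m => m ∣ n), auxS α Y m := by
  have h1 : (Z : ℝ) ^ (α / 4) ≤ (b : ℝ) ^ (α / 2) := by
    calc (Z : ℝ) ^ (α / 4) ≤ ((b : ℝ) ^ 2) ^ (α / 4) :=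
          Real.rpow_le_rpow (by positivity) (by exact_mod_cast hb2.le) (by positivity)
      _ = _ := by
        rw [← Real.rpow_natCast, ← Real.rpow_mul (by positivity)]; congr 1; push_cast; ring
  calc (Z : ℝ) ^ (α / 4) * (b.divisors.card : ℝ) ≤ (b : ℝ) ^ (α / 2) * (b.divisors.card : ℝ) := by
        gcongr
    _ ≤ ∑ m ∈ b.divisors, (m : ℝ) ^ α := by rw [mul_comm]; exact aux_rankin b α
    _ = ∑ m ∈ b.divisors, auxS α Y m := by
        refine Finset.sum_congr rfl fun m hm => ?_
        rw [auxS, if_pos]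
        intro r hr
        exact hs r (Nat.prime_of_mem_primeFactors hr)
          ((Nat.dvd_of_mem_primeFactors hr).trans (Nat.dvd_of_mem_divisors hm))
    _ ≤ _ := by
        refine Finset.sum_le_sum_of_subset_of_nonneg (fun m hm => ?_)
          (fun m _ _ => auxS_nonneg _ _ _)
        have hmb := Nat.dvd_of_mem_divisors hm
        rw [Finset.mem_filter, Finset.mem_Icc]
        exact ⟨⟨Nat.pos_of_mem_divisors hm, (Nat.le_of_dvd hb1 hmb).trans hbZ⟩, hmb.trans hb⟩

lemma aux_cnt (Z b n : ℕ) (hb1 : 1 ≤ b) (hb : b ∣ n) (hbZ : b ≤ Z) :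
    (b.divisors.card : ℝ) ≤ ((Finset.Icc 1 Z).filter (fun m => m ∣ n)).card := by
  have : b.divisors ⊆ (Finset.Icc 1 Z).filter (fun m => m ∣ n) := fun m hm => by
    have hmb := Nat.dvd_of_mem_divisors hm
    rw [Finset.mem_filter, Finset.mem_Icc]
    exact ⟨⟨Nat.pos_of_mem_divisors hm, (Nat.le_of_dvd hb1 hmb).trans hbZ⟩, hmb.trans hb⟩
  exact_mod_cast Finset.card_le_card this

lemma aux_weight (D : ℕ) (hD : 1 ≤ D) : ∃ C : ℝ, 0 < C ∧ ∀ Z : ℕ, 2 ≤ Z → ∃ w : ℕ → ℝ,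
    (∀ m, 0 ≤ w m) ∧
    (∀ n : ℕ, 1 ≤ n → n ≤ Z ^ D → (n.divisors.card : ℝ) ≤
      ∑ m ∈ (Finset.Icc 1 Z).filter (fun m => m ∣ n), w m) ∧
    ∑ m ∈ Finset.Icc 1 Z, w m / m ≤ C * (1 + Real.log Z) := by
  have hD0 : (0 : ℝ) < D := by exact_mod_cast hD
  obtain ⟨C2, hC2, hdb⟩ := aux_dbound (1 / (16 * D)) (by positivity)
  have hl2 : 0 < Real.log 2 := Real.log_pos (by norm_num)
  set β : ℝ := 4 * (D + 1) * Real.log 2 with hβ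
  have hβ0 : 0 < β := by positivity
  set C1 : ℝ := Real.exp (12 * β * Real.exp β) with hC1
  have hC10 : 0 < C1 := Real.exp_pos _
  refine ⟨4 ^ D + 2 ^ D * 2 * C1 + C2 * C1, by positivity, fun Z hZ => ?_⟩
  have hZ2 : (2 : ℝ) ≤ Z := by exact_mod_cast hZ
  have hZ0 : (0 : ℝ) < Z := by linarith
  have hlZ : 0 < Real.log Z := Real.log_pos (by linarith)
  set J : Finset ℕ := (Finset.range (Z + 1)).filter (fun j => 1 ≤ j ∧ 4 * β * j ≤ Real.log Z) with hJ
  set Y : ℕ → ℕ := fun j => ⌊(Z : ℝ) ^ (1 / (j : ℝ))⌋₊ with hY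
  set a : ℕ → ℝ := fun j => β * j / Real.log Z with ha
  set Y0 : ℕ := ⌊Real.exp (4 * β)⌋₊ with hY0
  set w : ℕ → ℝ := fun m => 4 ^ D + ∑ j ∈ J, 2 ^ D * (1 / 2) ^ j * auxS (a j) (Y j) m +
    C2 * auxS (1 / 4) Y0 m with hw
  have hS1 : ∀ m, 0 ≤ ∑ j ∈ J, 2 ^ D * (1 / 2 : ℝ) ^ j * auxS (a j) (Y j) m := fun m =>
    Finset.sum_nonneg fun j _ => mul_nonneg (by positivity) (auxS_nonneg _ _ _)
  have hS2 : ∀ m, 0 ≤ C2 * auxS (1 / 4) Y0 m := fun m =>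
    mul_nonneg (by linarith) (auxS_nonneg _ _ _)
  have h4D : (0 : ℝ) < 4 ^ D := by positivity
  refine ⟨w, fun m => by have := hS1 m; have := hS2 m; simp only [hw]; linarith, ?_, ?_⟩
  · intro n hn hnD
    have hw1 : ∑ m ∈ (Finset.Icc 1 Z).filter (fun m => m ∣ n), (4 : ℝ) ^ D ≤
        ∑ m ∈ (Finset.Icc 1 Z).filter (fun m => m ∣ n), w m :=
      Finset.sum_le_sum fun m _ => by have := hS1 m; have := hS2 m; simp only [hw]; linarith
    rw [Finset.sum_const, nsmul_eq_mul] at hw1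
    rcases le_or_gt n Z with hnZ | hnZ
    · refine le_trans ?_ hw1
      have := aux_cnt Z n n hn dvd_rfl hnZ
      have h1 : (1 : ℝ) ≤ 4 ^ D := one_le_pow₀ (by norm_num)
      nlinarith [(Nat.cast_nonneg ((Finset.Icc 1 Z).filter (fun m => m ∣ n)).card : (0:ℝ) ≤ _)]
    obtain ⟨b, p, c, rfl, hp, hb1, hbZ, hbp, hc, hsm, hro⟩ := aux_split Z n (by omega) hnZ
    have hbn : b ∣ b * (p * c) := dvd_mul_right _ _
    have hpc : p * c ≠ 0 := mul_ne_zero hp.ne_zero hc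
    have hpcZ : p * c ≤ Z ^ D := le_trans (Nat.le_mul_of_pos_left _ hb1) hnD
    set j := Nat.log p Z with hj
    have hj1 : p ^ j ≤ Z := Nat.pow_log_le_self p (by omega)
    have hj2 : Z < p ^ (j + 1) := Nat.lt_pow_succ_log_self hp.one_lt Z
    have hdc : (p * c).divisors.card ≤ 2 ^ ((j + 1) * D) := by
      refine aux_d_rough p (p * c) _ hp.two_le hpc hro (hpcZ.trans ?_)
      rw [pow_mul]; exact Nat.pow_le_pow_left hj2.le D
    have hdn : ((b * (p * c)).divisors.card : ℝ) ≤ b.divisors.card * (p * c).divisors.card := by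
      exact_mod_cast aux_dmul b (p * c)
    refine hdn.trans ?_
    have hdcR : ((p * c).divisors.card : ℝ) ≤ 2 ^ ((j + 1) * D) := by exact_mod_cast hdc
    by_cases hjle : j ≤ 1
    · refine le_trans ?_ hw1
      have h1 := aux_cnt Z b _ hb1 hbn hbZ
      have h2 : ((p * c).divisors.card : ℝ) ≤ 4 ^ D := by
        refine hdcR.trans ?_
        rw [show (4 : ℝ) = 2 ^ 2 by norm_num, ← pow_mul]
        exact pow_le_pow_right₀ (by norm_num) (Nat.mul_le_mul_right _ (by omega))
      gcongr
    push Not at hjle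
    have hp2Z : p ^ 2 ≤ Z := (Nat.pow_le_pow_right hp.pos hjle).trans hj1
    have hb2 : Z < b ^ 2 := by
      by_contra! hcon
      have : (b * p) ^ 2 ≤ Z ^ 2 := by
        rw [mul_pow, sq Z]; exact Nat.mul_le_mul hcon hp2Z
      have := (Nat.pow_le_pow_iff_left (by norm_num)).1 this
      omega
    have hp0 : (0 : ℝ) < p := by exact_mod_cast hp.pos
    have hj0 : (0 : ℝ) < j := by exact_mod_cast (by omega : 0 < j)
    have hj1R : (p : ℝ) ^ j ≤ Z := by exact_mod_cast hj1
    by_cases hjJ : 4 * β * j ≤ Real.log Z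
    · have hpY : p ≤ Y j := by
        apply Nat.le_floor
        calc (p : ℝ) = ((p : ℝ) ^ j) ^ (1 / (j : ℝ)) := by
              rw [← Real.rpow_natCast, ← Real.rpow_mul hp0.le, mul_one_div_cancel hj0.ne',
                Real.rpow_one]
          _ ≤ _ := Real.rpow_le_rpow (by positivity) hj1R (by positivity)
      have hmem : j ∈ J := by
        rw [hJ, Finset.mem_filter, Finset.mem_range]
        have : j ≤ Z := Nat.log_le_self p Z
        exact ⟨by omega, by omega, hjJ⟩
      have h1 := aux_pt (a j) (by simp only [ha]; positivity) (Y j) Z b _ hb1 hbn hbZ hb2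
        (fun r hr hrb => (hsm r hr hrb).trans hpY)
      have h2 : (Z : ℝ) ^ (a j / 4) = 2 ^ ((D + 1) * j) := by
        rw [Real.rpow_def_of_pos hZ0]
        have : Real.log Z * (a j / 4) = ((D + 1) * j : ℕ) * Real.log 2 := by
          simp only [ha, hβ]; push_cast; field_simp
        rw [this, ← Real.log_pow, Real.exp_log (by positivity)]
      rw [h2] at h1
      have h3 : ∑ m ∈ (Finset.Icc 1 Z).filter (fun m => m ∣ b * (p * c)),
          (2 ^ D * (1 / 2 : ℝ) ^ j * auxS (a j) (Y j) m) ≤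
          ∑ m ∈ (Finset.Icc 1 Z).filter (fun m => m ∣ b * (p * c)), w m := by
        refine Finset.sum_le_sum fun m _ => ?_
        have h5 := Finset.single_le_sum
          (f := fun j => 2 ^ D * (1 / 2 : ℝ) ^ j * auxS (a j) (Y j) m)
          (fun j _ => mul_nonneg (by positivity) (auxS_nonneg _ _ _)) hmem
        have := hS2 m
        simp only [hw]
        linarith
      refine le_trans ?_ h3
      rw [← Finset.mul_sum]
      calc (b.divisors.card : ℝ) * (p * c).divisors.card
          ≤ b.divisors.card * 2 ^ ((j + 1) * D) := by gcongr
        _ = 2 ^ D * (1 / 2 : ℝ) ^ j * (2 ^ ((D + 1) * j) * b.divisors.card) := by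
            have : (2 : ℝ) ^ ((j + 1) * D) = 2 ^ D * (1 / 2 : ℝ) ^ j * 2 ^ ((D + 1) * j) := by
              rw [show (j + 1) * D = D + D * j by ring, show (D + 1) * j = j + D * j by ring,
                pow_add, pow_add, one_div, inv_pow]
              field_simp
            rw [this]; ring
        _ ≤ _ := by gcongr
    · push Not at hjJ
      have hpY : p ≤ Y0 := by
        apply Nat.le_floor
        have h1 : (j : ℝ) * Real.log p ≤ Real.log Z := by
          rw [← Real.log_pow]; exact Real.log_le_log (by positivity) hj1R
        have h2 : Real.log p < 4 * β := by nlinarith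
        rw [← Real.log_le_iff_le_exp hp0]; exact h2.le
      have h1 := aux_pt (1 / 4) (by norm_num) Y0 Z b _ hb1 hbn hbZ hb2
        (fun r hr hrb => (hsm r hr hrb).trans hpY)
      have h3 : ∑ m ∈ (Finset.Icc 1 Z).filter (fun m => m ∣ b * (p * c)),
          C2 * auxS (1 / 4) Y0 m ≤
          ∑ m ∈ (Finset.Icc 1 Z).filter (fun m => m ∣ b * (p * c)), w m := by
        refine Finset.sum_le_sum fun m _ => ?_
        have := hS1 m
        simp only [hw]
        linarith
      refine le_trans ?_ h3
      rw [← Finset.mul_sum]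
      have h4 : ((p * c).divisors.card : ℝ) ≤ C2 * (Z : ℝ) ^ ((1 / 4 : ℝ) / 4) := by
        refine (hdb _ hpc).trans ?_
        gcongr
        calc ((p * c : ℕ) : ℝ) ^ (1 / (16 * D) : ℝ) ≤ ((Z : ℝ) ^ D) ^ (1 / (16 * D) : ℝ) :=
              Real.rpow_le_rpow (by positivity) (by exact_mod_cast hpcZ) (by positivity)
          _ = _ := by
            rw [← Real.rpow_natCast, ← Real.rpow_mul hZ0.le]; congr 1; field_simp; norm_num
      calc (b.divisors.card : ℝ) * (p * c).divisors.card
          ≤ b.divisors.card * (C2 * (Z : ℝ) ^ ((1 / 4 : ℝ) / 4)) := by gcongr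
        _ = C2 * ((Z : ℝ) ^ ((1 / 4 : ℝ) / 4) * b.divisors.card) := by ring
        _ ≤ _ := by gcongr
  · have hsm : ∀ (α : ℝ) (y : ℕ), 0 ≤ α → α ≤ 1 / 4 → α * Real.log y ≤ β →
        ∑ m ∈ Finset.Icc 1 Z, auxS α y m / m ≤ C1 * (1 + Real.log Z) := by
      intro α y h0 h1 h2
      refine le_trans (le_of_eq ?_) (aux_smooth α β h0 h1 y Z h2)
      rw [Finset.sum_filter]
      refine Finset.sum_congr rfl fun m _ => ?_
      unfold auxS; split_ifs <;> simp
    have e : ∑ m ∈ Finset.Icc 1 Z, w m / m = 4 ^ D * ∑ m ∈ Finset.Icc 1 Z, (1 : ℝ) / m +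
        ∑ j ∈ J, 2 ^ D * (1 / 2 : ℝ) ^ j * ∑ m ∈ Finset.Icc 1 Z, auxS (a j) (Y j) m / m +
        C2 * ∑ m ∈ Finset.Icc 1 Z, auxS (1 / 4) Y0 m / m := by
      simp only [Finset.mul_sum]
      rw [Finset.sum_comm, ← Finset.sum_add_distrib, ← Finset.sum_add_distrib]
      refine Finset.sum_congr rfl fun m _ => ?_
      simp only [hw, add_div, Finset.sum_div]
      congr 1
      · congr 1
        · ring
        · exact Finset.sum_congr rfl fun j _ => by ring
      · ring
    rw [e]
    have t1 := aux_harm Z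
    have t3 : ∑ m ∈ Finset.Icc 1 Z, auxS (1 / 4) Y0 m / m ≤ C1 * (1 + Real.log Z) := by
      apply hsm _ _ (by norm_num) le_rfl
      have : Real.log Y0 ≤ 4 * β := by
        rw [Real.log_le_iff_le_exp]
        · exact Nat.floor_le (Real.exp_pos _).le
        · have : 1 ≤ Y0 := Nat.le_floor (by simpa using Real.one_le_exp (by positivity))
          exact_mod_cast this
      linarith
    have t2 : ∑ j ∈ J, 2 ^ D * (1 / 2 : ℝ) ^ j * ∑ m ∈ Finset.Icc 1 Z, auxS (a j) (Y j) m / m ≤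
        2 ^ D * 2 * (C1 * (1 + Real.log Z)) := by
      calc _ ≤ ∑ j ∈ J, 2 ^ D * (1 / 2 : ℝ) ^ j * (C1 * (1 + Real.log Z)) := by
            refine Finset.sum_le_sum fun j hj => ?_
            rw [hJ, Finset.mem_filter] at hj
            obtain ⟨-, hj1, hj2⟩ := hj
            have hj0 : (0 : ℝ) < j := by exact_mod_cast hj1
            gcongr
            apply hsm
            · simp only [ha]; positivity
            · simp only [ha]; rw [div_le_iff₀ hlZ]; linarith
            · have hY1 : 1 ≤ Y j := Nat.le_floor (by
                simpa using Real.one_le_rpow (by linarith : (1:ℝ) ≤ Z) (by positivity : 0 ≤ 1 / (j : ℝ)))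
              have : Real.log (Y j) ≤ 1 / j * Real.log Z := by
                rw [← Real.log_rpow hZ0]
                exact Real.log_le_log (by exact_mod_cast hY1) (Nat.floor_le (by positivity))
              calc a j * Real.log (Y j) ≤ a j * (1 / j * Real.log Z) := by
                    gcongr
                _ = β := by simp only [ha]; field_simp
        _ = 2 ^ D * (∑ j ∈ J, (1 / 2 : ℝ) ^ j) * (C1 * (1 + Real.log Z)) := by
            rw [Finset.mul_sum, Finset.sum_mul]
        _ ≤ _ := by
            gcongr
            refine le_trans (Finset.sum_le_sum_of_subset_of_nonneg (Finset.filter_subset _ _)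
              (fun _ _ _ => by positivity)) (sum_geometric_two_le (Z + 1))
    calc _ ≤ 4 ^ D * (1 + Real.log Z) + 2 ^ D * 2 * (C1 * (1 + Real.log Z)) +
          C2 * (C1 * (1 + Real.log Z)) := by gcongr
      _ = _ := by ring

lemma aux_modcount (Z m v0 : ℕ) (hm : 1 ≤ m) (T : Finset ℕ) (hT : T ⊆ Finset.Icc 1 Z)
    (h : ∀ v ∈ T, v ≡ v0 [MOD m]) : (T.card : ℝ) ≤ Z / m + 1 := by
  have h1 : T ⊆ (Finset.Ioc 0 Z).filter (fun x => x ≡ v0 [MOD m]) := fun v hv => by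
    have := Finset.mem_Icc.1 (hT hv)
    rw [Finset.mem_filter, Finset.mem_Ioc]
    exact ⟨⟨this.1, this.2⟩, h v hv⟩
  have h2 := Finset.card_le_card h1
  have h3 := Nat.Ioc_filter_modEq_card 0 Z (r := m) hm v0
  have hm0 : (0 : ℚ) < m := by exact_mod_cast hm
  have h4 : (max (⌊((Z : ℚ) - v0) / m⌋ - ⌊(((0 : ℕ) : ℚ) - v0) / m⌋) 0 : ℚ) ≤ Z / m + 1 := by
    apply max_le
    · have e1 := Int.floor_le (((Z : ℚ) - v0) / m)
      have e2 := Int.lt_floor_add_one ((((0 : ℕ) : ℚ) - v0) / m)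
      rw [sub_div] at e1 e2
      simp only [Nat.cast_zero, zero_div] at *
      rw [sub_div, sub_div]
      rw [zero_div] at *
      linarith
    · positivity
  have h5 : (T.card : ℚ) ≤ Z / m + 1 := by
    refine le_trans ?_ h4
    have : ((T.card : ℤ)) ≤ max (⌊((Z : ℚ) - v0) / m⌋ - ⌊(((0 : ℕ) : ℚ) - v0) / m⌋) 0 := by
      rw [← h3]; exact_mod_cast h2
    exact_mod_cast this
  have h6 : (((T.card : ℚ)) : ℝ) ≤ ((Z / m + 1 : ℚ) : ℝ) := by exact_mod_cast h5
  push_cast at h6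
  exact h6

lemma aux_prog (D : ℕ) (hD : 1 ≤ D) : ∃ C : ℝ, 0 < C ∧ ∀ Z M a : ℕ, 2 ≤ Z → 1 ≤ M →
    Nat.Coprime M a → M * Z ≤ Z ^ D →
    ∑ v ∈ (Finset.Icc 1 Z).filter (fun v => a < M * v), ((M * v - a).divisors.card : ℝ) ≤
      C * (Z * (1 + Real.log Z)) := by
  obtain ⟨C, hC, hw⟩ := aux_weight D hD
  refine ⟨2 * C, by positivity, fun Z M a hZ hM hcop hMZ => ?_⟩
  obtain ⟨w, hw0, hw1, hw2⟩ := hw Z hZ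
  have h1 : ∑ v ∈ (Finset.Icc 1 Z).filter (fun v => a < M * v), ((M * v - a).divisors.card : ℝ) ≤
      ∑ v ∈ (Finset.Icc 1 Z).filter (fun v => a < M * v), ∑ m ∈ Finset.Icc 1 Z,
        (if m ∣ M * v - a then w m else 0) := by
    refine Finset.sum_le_sum fun v hv => ?_
    rw [Finset.mem_filter, Finset.mem_Icc] at hv
    rw [← Finset.sum_filter]
    refine hw1 _ (by omega) ?_
    have : M * v ≤ M * Z := Nat.mul_le_mul_left _ hv.1.2
    omega
  refine h1.trans ?_
  rw [Finset.sum_comm]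
  have h2 : ∑ m ∈ Finset.Icc 1 Z, ∑ v ∈ (Finset.Icc 1 Z).filter (fun v => a < M * v),
        (if m ∣ M * v - a then w m else 0) ≤ ∑ m ∈ Finset.Icc 1 Z, 2 * Z * (w m / m) := by
    refine Finset.sum_le_sum fun m hm => ?_
    rw [Finset.mem_Icc] at hm
    have hm0 : (0 : ℝ) < m := by exact_mod_cast hm.1
    rw [← Finset.sum_filter, Finset.sum_const, nsmul_eq_mul]
    set T := ((Finset.Icc 1 Z).filter (fun v => a < M * v)).filter (fun v => m ∣ M * v - a) with hT
    have hcard : (T.card : ℝ) ≤ 2 * Z / m := by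
      rcases T.eq_empty_or_nonempty with h0 | ⟨v0, hv0⟩
      · rw [h0]; simp; positivity
      have key : ∀ v ∈ T, a < M * v ∧ m ∣ M * v - a := fun v hv => by
        rw [hT, Finset.mem_filter, Finset.mem_filter] at hv
        exact ⟨hv.1.2, hv.2⟩
      have hmM : Nat.Coprime m M := by
        apply Nat.Coprime.symm
        apply Nat.coprime_of_dvd
        intro r hr hrM hrm
        obtain ⟨k1, k2⟩ := key v0 hv0
        have h3 : r ∣ M * v0 - a := hrm.trans k2
        have h4 : r ∣ a := by
          have h5 : r ∣ M * v0 := hrM.mul_right _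
          have := Nat.dvd_sub h5 h3
          rwa [Nat.sub_sub_self k1.le] at this
        have := Nat.dvd_gcd hrM h4
        rw [hcop] at this
        exact hr.one_lt.ne' (Nat.dvd_one.1 this)
      have h3 := aux_modcount Z m v0 hm.1 T
        ((Finset.filter_subset _ _).trans (Finset.filter_subset _ _)) (fun v hv => by
          obtain ⟨k1, k2⟩ := key v0 hv0
          obtain ⟨k3, k4⟩ := key v hv
          have e1 : a ≡ M * v [MOD m] := (Nat.modEq_iff_dvd' k3.le).2 k4
          have e2 : a ≡ M * v0 [MOD m] := (Nat.modEq_iff_dvd' k1.le).2 k2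
          exact Nat.ModEq.cancel_left_of_coprime hmM (e1.symm.trans e2))
      have h4 : (1 : ℝ) ≤ Z / m := by
        rw [le_div_iff₀ hm0, one_mul]; exact_mod_cast hm.2
      calc (T.card : ℝ) ≤ Z / m + 1 := h3
        _ ≤ Z / m + Z / m := by linarith
        _ = _ := by ring
    calc (T.card : ℝ) * w m ≤ 2 * Z / m * w m := mul_le_mul_of_nonneg_right hcard (hw0 m)
      _ = _ := by ring
  refine h2.trans ?_
  rw [← Finset.mul_sum]
  calc 2 * (Z : ℝ) * ∑ m ∈ Finset.Icc 1 Z, w m / m ≤ 2 * Z * (C * (1 + Real.log Z)) := by gcongr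
    _ = _ := by ring

lemma aux_prog2 (D : ℕ) (hD : 1 ≤ D) : ∃ C : ℝ, 0 < C ∧ ∀ Z M a : ℕ, 2 ≤ Z → 1 ≤ M →
    M * Z ≤ Z ^ D →
    ∑ v ∈ (Finset.Icc 1 Z).filter (fun v => a < M * v), ((M * v - a).divisors.card : ℝ) ≤
      C * (M.divisors.card * (Z * (1 + Real.log Z))) := by
  obtain ⟨C, hC, h⟩ := aux_prog D hD
  refine ⟨C, hC, fun Z M a hZ hM hMZ => ?_⟩
  have hg : 0 < Nat.gcd M a := Nat.gcd_pos_of_pos_left _ hM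
  obtain ⟨g, M', a', hg0, hcop, rfl, rfl⟩ := Nat.exists_coprime' hg
  have hM' : 1 ≤ M' := Nat.pos_of_mul_pos_right hM
  have h1 := h Z M' a' hZ hM' hcop (le_trans (Nat.mul_le_mul_right _ (Nat.le_mul_of_pos_right _ hg0)) hMZ)
  have hf : (Finset.Icc 1 Z).filter (fun v => a' * g < M' * g * v) =
      (Finset.Icc 1 Z).filter (fun v => a' < M' * v) := by
    refine Finset.filter_congr fun v _ => ?_
    rw [show M' * g * v = (M' * v) * g by ring]
    exact Nat.mul_lt_mul_right hg0
  rw [hf]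
  have hgd : (g.divisors.card : ℝ) ≤ (M' * g).divisors.card := by
    have := Finset.card_le_card (Nat.divisors_subset_of_dvd (by omega : M' * g ≠ 0) (dvd_mul_left g M'))
    exact_mod_cast this
  have hlZ : 0 ≤ Real.log Z := Real.log_natCast_nonneg Z
  calc ∑ v ∈ (Finset.Icc 1 Z).filter (fun v => a' < M' * v), ((M' * g * v - a' * g).divisors.card : ℝ)
      ≤ ∑ v ∈ (Finset.Icc 1 Z).filter (fun v => a' < M' * v),
        (g.divisors.card : ℝ) * ((M' * v - a').divisors.card : ℝ) := by
        refine Finset.sum_le_sum fun v _ => ?_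
        rw [show M' * g * v - a' * g = g * (M' * v - a') by rw [Nat.mul_sub]; congr 1 <;> ring]
        exact_mod_cast aux_dmul _ _
    _ = g.divisors.card * ∑ v ∈ (Finset.Icc 1 Z).filter (fun v => a' < M' * v),
        ((M' * v - a').divisors.card : ℝ) := by rw [Finset.mul_sum]
    _ ≤ (M' * g).divisors.card * (C * (Z * (1 + Real.log Z))) := by gcongr
    _ = _ := by ring

lemma aux_dsq (k : ℕ) (hk : k ≠ 0) :
    (k ^ 2).divisors.card ≤ ∑ e ∈ k.divisors, e.divisors.card := by
  rw [← Finset.card_sigma]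
  refine Finset.card_le_card_of_injOn (fun d => (⟨Nat.gcd d k, d / Nat.gcd d k⟩ : (_ : ℕ) × ℕ)) ?_ ?_
  · intro d hd
    have hd' : d ∣ k ^ 2 := Nat.dvd_of_mem_divisors hd
    have hg : 0 < Nat.gcd d k := Nat.gcd_pos_of_pos_right _ (Nat.pos_of_ne_zero hk)
    simp only [Finset.coe_sigma, Set.mem_sigma_iff, Finset.mem_coe, Nat.mem_divisors]
    refine ⟨⟨Nat.gcd_dvd_right _ _, hk⟩, ?_, hg.ne'⟩
    obtain ⟨g, h, m, hg0, hcop, hd1, hk1⟩ := Nat.exists_coprime' hg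
    have hgg : Nat.gcd d k = g := by
      rw [hd1, hk1, Nat.gcd_mul_right, hcop, one_mul]
    rw [hgg]
    have e : d / g = h := by rw [hd1, Nat.mul_div_cancel _ hg0]
    rw [e]
    rw [hd1, hk1] at hd'
    have h1 : h * g ∣ (m ^ 2 * g) * g := by
      rw [show m ^ 2 * g * g = (m * g) ^ 2 by ring]; exact hd'
    have h2 := Nat.dvd_of_mul_dvd_mul_right hg0 h1
    exact (Nat.Coprime.pow_right 2 hcop).dvd_of_dvd_mul_left h2
  · intro d1 _ d2 _ h12
    simp only [Sigma.mk.injEq, heq_eq_eq] at h12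
    rw [← Nat.div_mul_cancel (Nat.gcd_dvd_left d1 k), ← Nat.div_mul_cancel (Nat.gcd_dvd_left d2 k),
      h12.2, h12.1]

lemma aux_divsum (N : ℕ) (f : ℕ → ℝ) (k : ℕ) (hk : k ∈ Finset.Icc 1 N) :
    ∑ e ∈ k.divisors, f e = ∑ e ∈ Finset.Icc 1 N, if e ∣ k then f e else 0 := by
  rw [← Finset.sum_filter]
  refine Finset.sum_congr ?_ fun _ _ => rfl
  rw [Finset.mem_Icc] at hk
  ext e
  rw [Nat.mem_divisors, Finset.mem_filter, Finset.mem_Icc]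
  constructor
  · rintro ⟨h1, h2⟩
    exact ⟨⟨Nat.pos_of_dvd_of_pos h1 hk.1, (Nat.le_of_dvd hk.1 h1).trans hk.2⟩, h1⟩
  · rintro ⟨_, h1⟩
    exact ⟨h1, by omega⟩

lemma aux_sumdsq (N : ℕ) :
    ∑ k ∈ Finset.Icc 1 N, ((k ^ 2).divisors.card : ℝ) ≤ N * (1 + Real.log N) ^ 2 := by
  have h1 : ∑ k ∈ Finset.Icc 1 N, ((k ^ 2).divisors.card : ℝ) ≤
      ∑ k ∈ Finset.Icc 1 N, ∑ e ∈ Finset.Icc 1 N, if e ∣ k then (e.divisors.card : ℝ) else 0 := by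
    refine Finset.sum_le_sum fun k hk => ?_
    rw [← aux_divsum N (fun e => (e.divisors.card : ℝ)) k hk]
    have := aux_dsq k (by have := (Finset.mem_Icc.1 hk).1; omega)
    exact_mod_cast this
  rw [Finset.sum_comm] at h1
  have h2 : ∑ e ∈ Finset.Icc 1 N, ∑ k ∈ Finset.Icc 1 N, (if e ∣ k then (e.divisors.card : ℝ) else 0)
      ≤ ∑ e ∈ Finset.Icc 1 N, N * ((e.divisors.card : ℝ) / e) := by
    refine Finset.sum_le_sum fun e he => ?_
    have he1 := (Finset.mem_Icc.1 he).1
    rw [← Finset.sum_filter, aux_sum_dvd e N he1, Finset.sum_const, nsmul_eq_mul, Nat.card_Icc,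
      Nat.add_sub_cancel]
    have : ((N / e : ℕ) : ℝ) ≤ N / e := Nat.cast_div_le
    calc _ ≤ ((N : ℝ) / e) * (e.divisors.card : ℝ) := by gcongr
      _ = _ := by ring
  have h3 : ∑ e ∈ Finset.Icc 1 N, ((e.divisors.card : ℝ) / e) ≤ (1 + Real.log N) ^ 2 := by
    have e1 : ∑ e ∈ Finset.Icc 1 N, ((e.divisors.card : ℝ) / e) =
        ∑ e ∈ Finset.Icc 1 N, ∑ f ∈ Finset.Icc 1 N, if f ∣ e then (1 / e : ℝ) else 0 := by
      refine Finset.sum_congr rfl fun e he => ?_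
      rw [← aux_divsum N (fun _ => (1 / e : ℝ)) e he, Finset.sum_const, nsmul_eq_mul]; ring
    rw [e1, Finset.sum_comm]
    have hH := aux_harm N
    have hH0 : 0 ≤ ∑ m ∈ Finset.Icc 1 N, (1 : ℝ) / m := Finset.sum_nonneg fun _ _ => by positivity
    calc _ ≤ ∑ f ∈ Finset.Icc 1 N, (1 / (f : ℝ)) * ∑ m ∈ Finset.Icc 1 N, (1 : ℝ) / m := by
          refine Finset.sum_le_sum fun f hf => ?_
          have hf1 := (Finset.mem_Icc.1 hf).1
          rw [← Finset.sum_filter, aux_sum_dvd f N hf1, Finset.mul_sum]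
          refine le_trans (le_of_eq ?_) (Finset.sum_le_sum_of_subset_of_nonneg
            (Finset.Icc_subset_Icc_right (Nat.div_le_self N f)) fun _ _ _ => by positivity)
          refine Finset.sum_congr rfl fun m _ => ?_
          push_cast; rw [one_div_mul_one_div]
      _ = (∑ m ∈ Finset.Icc 1 N, (1 : ℝ) / m) * ∑ m ∈ Finset.Icc 1 N, (1 : ℝ) / m := by
          rw [Finset.sum_mul]
      _ ≤ _ := by rw [sq]; gcongr
  refine h1.trans (h2.trans ?_)
  rw [← Finset.mul_sum]
  gcongr

lemma aux_term (k l v q : ℕ) :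
    (if 1 ≤ (k : ℤ) ^ 2 * v - l * q then
      ((((k : ℤ) ^ 2 * v - l * q).toNat.divisors.card : ℝ)) else 0) =
    if l * q < k ^ 2 * v then ((k ^ 2 * v - l * q).divisors.card : ℝ) else 0 := by
  have e : ((k : ℤ) ^ 2 * v - l * q).toNat = k ^ 2 * v - l * q := by
    rw [show (k : ℤ) ^ 2 * v - l * q = ((k ^ 2 * v : ℕ) : ℤ) - ((l * q : ℕ) : ℤ) by push_cast; ring]
    exact Int.toNat_sub _ _
  rw [e]
  have e2 : (1 ≤ (k : ℤ) ^ 2 * v - l * q) ↔ l * q < k ^ 2 * v := by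
    rw [show (k : ℤ) ^ 2 * v - l * q = ((k ^ 2 * v : ℕ) : ℤ) - ((l * q : ℕ) : ℤ) by push_cast; ring]
    omega
  simp only [e2]

lemma aux_fin1 (x y c s t u : ℝ) (h1 : x ≤ y) (h2 : s ≤ t) (hx : 0 ≤ x) (hc : 0 ≤ c)
    (hs : 0 ≤ s) (hu : 0 ≤ u) : x * (c * (s * u)) ≤ y * (c * (t * u)) := by
  have : 0 ≤ y := hx.trans h1
  gcongr

lemma aux_fin2 (a b x s t : ℝ) (ha : 0 ≤ a) (hb : 0 ≤ b) (hx : 0 ≤ x) (hs : 0 ≤ s)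
    (ht : 0 ≤ t) : b * x * t ≤ (a + b) * x * (s + t) := by
  gcongr <;> linarith

set_option maxHeartbeats 800000 in
theorem statement17 (η : ℝ) (hη : 0 < η) :
    ∃ A : ℝ, 0 < A ∧ ∀ (q : ℕ) (K S X : ℝ), 1 ≤ q → 1 ≤ K → 1 ≤ S → 1 ≤ X →
      S ≤ X / K ^ 2 →
      (∑ k ∈ Finset.Ioc ⌊K⌋₊ ⌊2 * K⌋₊, ∑ l ∈ Finset.Icc 1 ⌊X / q⌋₊,
          ∑ v ∈ Finset.Icc 1 ⌊S⌋₊,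
            (if 1 ≤ (k : ℤ) ^ 2 * v - l * q then
              ((((k : ℤ) ^ 2 * v - l * q).toNat.divisors.card : ℝ)) else 0))
        ≤ A * (X / q) * (X ^ ((1 : ℝ)/2 + η) + X / K * (Real.log (2 * X)) ^ 3) := by
  obtain ⟨C1, hC1, hdb⟩ := aux_dbound (η / 2) (by positivity)
  set t : ℕ := ⌈2 / η⌉₊ with ht
  obtain ⟨C2, hC2, hprog⟩ := aux_prog2 (t + 1) (by omega)
  have h4η : (0 : ℝ) < (4 : ℝ) ^ (η / 2) := by positivity
  refine ⟨8 * (C1 * 4 ^ (η / 2)) + 54 * C2, by positivity, ?_⟩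
  intro q K S X hq hK hS hX hSX
  simp only [aux_term]
  have hq0 : (0 : ℝ) < q := by exact_mod_cast hq
  have hX0 : 0 < X := by linarith
  have hK0 : 0 < K := by linarith
  have hKS : K ^ 2 * S ≤ X := by
    rw [le_div_iff₀ (by positivity)] at hSX; linarith
  have hKX2 : K ^ 2 ≤ X := by nlinarith [sq_nonneg K]
  have hKX : K ≤ X := by nlinarith
  have hSleX : S ≤ X := by
    have h1 : 1 ≤ K ^ 2 := one_le_pow₀ hK
    nlinarith
  have hZS : (⌊S⌋₊ : ℝ) ≤ S := Nat.floor_le (by linarith)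
  have hlcard : ((⌊X / q⌋₊ : ℕ) : ℝ) ≤ X / q := Nat.floor_le (by positivity)
  have hNK : (⌊2 * K⌋₊ : ℝ) ≤ 2 * K := Nat.floor_le (by linarith)
  set L := Real.log (2 * X) with hL
  have hl2 : 1 / 2 < Real.log 2 := by linarith [Real.log_two_gt_d9]
  have hL2 : 1 / 2 < L := lt_of_lt_of_le hl2 (Real.log_le_log (by norm_num) (by linarith))
  have hXq : 0 < X / q := by positivity
  have hterm1 : 0 ≤ X ^ ((1 : ℝ)/2 + η) := by positivity
  have hterm2 : 0 ≤ X / K * L ^ 3 := by positivity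
  have hk2 : ∀ k ∈ Finset.Ioc ⌊K⌋₊ ⌊2 * K⌋₊, 1 ≤ k ∧ (k : ℝ) ^ 2 * ⌊S⌋₊ ≤ 4 * X := by
    intro k hk
    rw [Finset.mem_Ioc] at hk
    refine ⟨by omega, ?_⟩
    have h1 : (k : ℝ) ≤ 2 * K := le_trans (by exact_mod_cast hk.2) hNK
    calc (k : ℝ) ^ 2 * ⌊S⌋₊ ≤ (2 * K) ^ 2 * S := by gcongr
      _ = 4 * (K ^ 2 * S) := by ring
      _ ≤ _ := by linarith
  by_cases hcase : S ≤ 4 * X ^ (η / 2)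
  · -- trivial bound
    have hb : ∀ k ∈ Finset.Ioc ⌊K⌋₊ ⌊2 * K⌋₊, ∀ l ∈ Finset.Icc 1 ⌊X / q⌋₊,
        ∀ v ∈ Finset.Icc 1 ⌊S⌋₊,
        (if l * q < k ^ 2 * v then ((k ^ 2 * v - l * q).divisors.card : ℝ) else 0) ≤
          C1 * (4 ^ (η / 2) * X ^ (η / 2)) := by
      intro k hk l hl v hv
      split_ifs with h
      · refine (hdb _ (by omega)).trans ?_
        rw [← Real.mul_rpow (by norm_num) hX0.le]
        gcongr
        have h1 : ((k ^ 2 * v - l * q : ℕ) : ℝ) ≤ ((k ^ 2 * ⌊S⌋₊ : ℕ) : ℝ) := by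
          have := Nat.mul_le_mul_left (k ^ 2) (Finset.mem_Icc.1 hv).2
          exact_mod_cast (Nat.sub_le _ _).trans this
        refine h1.trans ?_
        push_cast
        exact (hk2 k hk).2
      · positivity
    set B := C1 * (4 ^ (η / 2) * X ^ (η / 2)) with hB
    have hB0 : 0 ≤ B := by positivity
    have hKsq : K ≤ X ^ ((1 : ℝ) / 2) := by
      rw [← Real.sqrt_eq_rpow]; exact Real.le_sqrt_of_sq_le hKX2
    calc _ ≤ ∑ k ∈ Finset.Ioc ⌊K⌋₊ ⌊2 * K⌋₊, ∑ l ∈ Finset.Icc 1 ⌊X / q⌋₊,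
          ∑ v ∈ Finset.Icc 1 ⌊S⌋₊, B :=
          Finset.sum_le_sum fun k hk => Finset.sum_le_sum fun l hl => Finset.sum_le_sum fun v hv =>
            hb k hk l hl v hv
      _ = ((⌊2 * K⌋₊ - ⌊K⌋₊ : ℕ) : ℝ) * ((⌊X / q⌋₊ : ℝ) * ((⌊S⌋₊ : ℝ) * B)) := by
          simp [Finset.sum_const, nsmul_eq_mul]
      _ ≤ (2 * X ^ ((1 : ℝ) / 2)) * ((X / q) * ((4 * X ^ (η / 2)) * B)) := by
          have h1 : ((⌊2 * K⌋₊ - ⌊K⌋₊ : ℕ) : ℝ) ≤ 2 * X ^ ((1 : ℝ) / 2) := by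
            have : ((⌊2 * K⌋₊ - ⌊K⌋₊ : ℕ) : ℝ) ≤ (⌊2 * K⌋₊ : ℝ) := by
              exact_mod_cast Nat.sub_le _ _
            linarith
          have h2 := hZS.trans hcase
          gcongr
      _ = 8 * (C1 * 4 ^ (η / 2)) * (X / q) * X ^ ((1 : ℝ)/2 + η) := by
          have : X ^ ((1 : ℝ)/2 + η) = X ^ ((1 : ℝ) / 2) * (X ^ (η / 2) * X ^ (η / 2)) := by
            rw [← Real.rpow_add hX0, ← Real.rpow_add hX0]; congr 1; ring
          rw [this, hB]; ring
      _ ≤ (8 * (C1 * 4 ^ (η / 2)) + 54 * C2) * (X / q) *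
          (X ^ ((1 : ℝ)/2 + η) + X / K * L ^ 3) := by
          gcongr
          · linarith
          · linarith
  · push Not at hcase
    set Z := ⌊S⌋₊ with hZ
    have hXη : 1 ≤ X ^ (η / 2) := Real.one_le_rpow hX (by positivity)
    have hZ4 : 4 ≤ Z := Nat.le_floor (by push_cast; linarith)
    have hZ4R : (4 : ℝ) ≤ Z := by exact_mod_cast hZ4
    have hSZ : S < Z + 1 := Nat.lt_floor_add_one S
    have hZX : X ^ (η / 2) ≤ Z := by linarith
    have hXZ : X ≤ (Z : ℝ) ^ t := by
      calc X = (X ^ (η / 2)) ^ (2 / η) := by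
            rw [← Real.rpow_mul hX0.le]; rw [show η / 2 * (2 / η) = 1 by field_simp, Real.rpow_one]
        _ ≤ (Z : ℝ) ^ (2 / η) := Real.rpow_le_rpow (by positivity) hZX (by positivity)
        _ ≤ (Z : ℝ) ^ (t : ℝ) := Real.rpow_le_rpow_of_exponent_le (by linarith) (Nat.le_ceil _)
        _ = _ := Real.rpow_natCast _ _
    have h4X : 4 * X ≤ (Z : ℝ) ^ (t + 1) := by
      rw [pow_succ, mul_comm]; gcongr
    have hlogZ : 1 + Real.log Z ≤ 3 * L := by
      have : Real.log Z ≤ L := Real.log_le_log (by linarith) (by linarith)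
      linarith
    have hlogZ0 : 0 ≤ Real.log Z := Real.log_natCast_nonneg Z
    have hmain : ∀ k ∈ Finset.Ioc ⌊K⌋₊ ⌊2 * K⌋₊, ∀ l ∈ Finset.Icc 1 ⌊X / q⌋₊,
        ∑ v ∈ Finset.Icc 1 Z,
        (if l * q < k ^ 2 * v then ((k ^ 2 * v - l * q).divisors.card : ℝ) else 0) ≤
          C2 * ((k ^ 2).divisors.card * (S * (3 * L))) := by
      intro k hk l hl
      obtain ⟨h1, h2⟩ := hk2 k hk
      rw [← Finset.sum_filter]
      refine (hprog Z (k ^ 2) (l * q) (by omega) (Nat.one_le_pow _ _ h1) ?_).trans ?_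
      · have := h2.trans h4X
        exact_mod_cast this
      · gcongr
    have hN1 : 1 ≤ ⌊2 * K⌋₊ := Nat.le_floor (by push_cast; linarith)
    have hlogN : 1 + Real.log ⌊2 * K⌋₊ ≤ 3 * L := by
      have : Real.log ⌊2 * K⌋₊ ≤ L :=
        Real.log_le_log (by exact_mod_cast hN1) (by linarith)
      linarith
    have hlogN0 : 0 ≤ Real.log ⌊2 * K⌋₊ := Real.log_natCast_nonneg _
    have hdsum : ∑ k ∈ Finset.Ioc ⌊K⌋₊ ⌊2 * K⌋₊, ((k ^ 2).divisors.card : ℝ) ≤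
        2 * K * (3 * L) ^ 2 := by
      calc _ ≤ ∑ k ∈ Finset.Icc 1 ⌊2 * K⌋₊, ((k ^ 2).divisors.card : ℝ) := by
            refine Finset.sum_le_sum_of_subset_of_nonneg (fun k hk => ?_) fun _ _ _ => by positivity
            rw [Finset.mem_Ioc] at hk
            rw [Finset.mem_Icc]
            omega
        _ ≤ _ := aux_sumdsq _
        _ ≤ _ := by gcongr
    calc _ ≤ ∑ k ∈ Finset.Ioc ⌊K⌋₊ ⌊2 * K⌋₊, ∑ l ∈ Finset.Icc 1 ⌊X / q⌋₊,
          C2 * ((k ^ 2).divisors.card * (S * (3 * L))) :=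
          Finset.sum_le_sum fun k hk => Finset.sum_le_sum fun l hl => hmain k hk l hl
      _ = (⌊X / q⌋₊ : ℝ) * (C2 * ((∑ k ∈ Finset.Ioc ⌊K⌋₊ ⌊2 * K⌋₊, ((k ^ 2).divisors.card : ℝ)) *
            (S * (3 * L)))) := by
          simp only [Finset.sum_const, nsmul_eq_mul, Nat.card_Icc, Nat.add_sub_cancel]
          rw [Finset.sum_mul, Finset.mul_sum, Finset.mul_sum]
      _ ≤ (X / q) * (C2 * ((2 * K * (3 * L) ^ 2) * (S * (3 * L)))) :=
          aux_fin1 _ _ _ _ _ _ hlcard hdsum (Nat.cast_nonneg _) hC2.le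
            (Finset.sum_nonneg fun _ _ => Nat.cast_nonneg _)
            (mul_nonneg (by linarith) (by linarith))
      _ = 54 * C2 * (X / q) * ((K * S) * L ^ 3) := by ring
      _ ≤ 54 * C2 * (X / q) * (X / K * L ^ 3) := by
          have : K * S ≤ X / K := by
            rw [le_div_iff₀ hK0]; linarith
          gcongr
      _ ≤ (8 * (C1 * 4 ^ (η / 2)) + 54 * C2) * (X / q) *
          (X ^ ((1 : ℝ)/2 + η) + X / K * L ^ 3) := by
          have h8 : 0 ≤ 8 * (C1 * (4 : ℝ) ^ (η / 2)) :=
            mul_nonneg (by norm_num) (mul_nonneg (by linarith) h4η.le)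
          exact aux_fin2 _ _ _ _ _ h8 (by linarith) hXq.le hterm1 hterm2
end

section
/- Let p be an odd prime, m₂ a nonzero integer and q an integer with p ∤ m₂q, and let b, c, d be integers. Define S₁(p,q,m₂;b,c,d) = Σ_{α,β,γ=1}^{p} ((m₂α²β − qγ)/p)·e((bα + cβ + dγ)/p), where (·/p) is the Legendre symbol and e(x) = e^{2πix}. Then S₁(p,q,m₂;b,c,0) = 0, and |S₁(p,q,m₂;b,c,d)| ≤ 2·p^{3/2} for all integers d. -/
open scoped BigOperators

/-- `e(x) = e^{2πix}`. -/
noncomputable def eC (x : ℝ) : ℂ := Complex.exp (2 * Real.pi * Complex.I * x)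

/-- The complete exponential sum
`S₁(p,q,m₂;b,c,d) = Σ_{α,β,γ=1}^{p} ((m₂α²β − qγ)/p)·e((bα + cβ + dγ)/p)`. -/
noncomputable def S1 (p : ℕ) [Fact p.Prime] (q m₂ b c d : ℤ) : ℂ :=
  ∑ α ∈ Finset.Icc 1 p, ∑ β ∈ Finset.Icc 1 p, ∑ γ ∈ Finset.Icc 1 p,
    ((legendreSym p (m₂ * (α : ℤ) ^ 2 * β - q * γ) : ℤ) : ℂ) *
      eC (((b * α + c * β + d * γ : ℤ) : ℝ) / p)


lemma aux_sum_Icc (p : ℕ) [Fact p.Prime] (f : ZMod p → ℂ) :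
    ∑ a ∈ Finset.Icc 1 p, f (a : ZMod p) = ∑ x : ZMod p, f x := by
  have hp : 0 < p := (Fact.out : p.Prime).pos
  refine Finset.sum_nbij' (fun a => (a : ZMod p)) (fun x => if x = 0 then p else x.val) ?_ ?_ ?_ ?_ ?_
  · simp
  · intro x _
    by_cases hx : x = 0
    · simp [hx]; omega
    · have h1 : x.val ≠ 0 := by simpa using hx
      have h2 := ZMod.val_lt x
      simp only [hx, if_false, Finset.mem_Icc]; omega
  · intro a ha
    rw [Finset.mem_Icc] at ha
    by_cases h : a = p
    · simp [h]
    · have hl : a < p := by omega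
      have h0 : (a : ZMod p) ≠ 0 := by
        rw [Ne, ZMod.natCast_eq_zero_iff]
        intro hd
        have := Nat.le_of_dvd (by omega) hd
        omega
      simp only [h0, if_false]
      exact ZMod.val_cast_of_lt hl
  · intro x _
    by_cases hx : x = 0
    · simp [hx]
    · simp [hx]
  · intro a _; rfl

noncomputable def auxChi (p : ℕ) [Fact p.Prime] : MulChar (ZMod p) ℂ :=
  (quadraticChar (ZMod p)).ringHomComp (Int.castRingHom ℂ)

lemma aux_eC (p : ℕ) [Fact p.Prime] (n : ℤ) :
    eC ((n : ℝ) / p) = ZMod.stdAddChar (N := p) (n : ZMod p) := by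
  rw [ZMod.stdAddChar_coe, eC]
  congr 1
  push_cast
  ring

lemma aux_S1 (p : ℕ) [Fact p.Prime] (q m b c d : ℤ) :
    S1 p q m b c d = ∑ x : ZMod p, ∑ y : ZMod p, ∑ z : ZMod p,
      auxChi p (m * x ^ 2 * y - q * z) * ZMod.stdAddChar (N := p) (b * x + c * y + d * z) := by
  rw [← aux_sum_Icc]
  unfold S1
  refine Finset.sum_congr rfl fun a _ => ?_
  rw [← aux_sum_Icc]
  refine Finset.sum_congr rfl fun a _ => ?_
  rw [← aux_sum_Icc]
  refine Finset.sum_congr rfl fun a _ => ?_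
  rw [aux_eC]
  simp [auxChi, legendreSym]

lemma aux_inner (p : ℕ) [Fact p.Prime] (q d A : ZMod p) (hq : q ≠ 0) :
    ∑ z : ZMod p, auxChi p (A - q * z) * ZMod.stdAddChar (N := p) (d * z) =
      ZMod.stdAddChar (N := p) (d * q⁻¹ * A) *
        gaussSum (auxChi p) (AddChar.mulShift (ZMod.stdAddChar (N := p)) (-(d * q⁻¹))) := by
  rw [gaussSum, Finset.mul_sum]
  refine Finset.sum_nbij' (fun z => A - q * z) (fun t => q⁻¹ * (A - t)) ?_ ?_ ?_ ?_ ?_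
  · simp
  · simp
  · intro z _; field_simp; ring
  · intro z _; field_simp; ring
  · intro z _
    have : d * z = d * q⁻¹ * A + -(d * q⁻¹) * (A - q * z) := by field_simp; ring
    rw [AddChar.mulShift_apply, this, AddChar.map_add_eq_mul]
    ring

lemma aux_gauss_zero (p : ℕ) [Fact p.Prime] (hp : p ≠ 2) :
    gaussSum (auxChi p) (AddChar.mulShift (ZMod.stdAddChar (N := p)) 0) = 0 := by
  have h := quadraticChar_sum_zero (F := ZMod p) (by rwa [ZMod.ringChar_zmod_n])
  have h2 := congrArg (Int.cast : ℤ → ℂ) h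
  simpa [gaussSum, auxChi] using h2

lemma aux_gauss_norm (p : ℕ) [Fact p.Prime] (hp : p ≠ 2) (a : ZMod p) (ha : a ≠ 0) :
    ‖gaussSum (auxChi p) (AddChar.mulShift (ZMod.stdAddChar (N := p)) a)‖ ^ 2 = p := by
  have hprim : (AddChar.mulShift (ZMod.stdAddChar (N := p)) a).IsPrimitive :=
    AddChar.IsPrimitive.of_ne_one (ZMod.isPrimitive_stdAddChar p ha)
  have hc : ringChar (ZMod p) ≠ 2 := by rwa [ZMod.ringChar_zmod_n]
  have hquad : (auxChi p).IsQuadratic := (quadraticChar_isQuadratic _).comp _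
  have hne : auxChi p ≠ 1 :=
    (MulChar.ringHomComp_ne_one_iff (RingHom.injective_int _)).mpr (quadraticChar_ne_one hc)
  have h := gaussSum_sq hne hquad hprim
  have hn : ‖auxChi p (-1)‖ = 1 := by
    have : auxChi p (-1) ^ 2 = 1 := by rw [← map_pow]; simp
    have := congrArg norm this
    rw [norm_pow, norm_one] at this
    exact (pow_eq_one_iff_of_nonneg (norm_nonneg _) two_ne_zero).mp this
  rw [← norm_pow, h, norm_mul, hn]
  simp [ZMod.card]

lemma aux_double (p : ℕ) [Fact p.Prime] (hp : p ≠ 2) (b c k : ZMod p) (hk : k ≠ 0) :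
    ‖∑ x : ZMod p, ∑ y : ZMod p, ZMod.stdAddChar (N := p) (b * x + c * y + k * x ^ 2 * y)‖
      ≤ 2 * p := by
  have h1 : ∀ x : ZMod p,
      ‖∑ y : ZMod p, ZMod.stdAddChar (N := p) (b * x + c * y + k * x ^ 2 * y)‖ =
        if c + k * x ^ 2 = 0 then (p : ℝ) else 0 := by
    intro x
    have : ∀ y : ZMod p, ZMod.stdAddChar (N := p) (b * x + c * y + k * x ^ 2 * y) =
        ZMod.stdAddChar (N := p) (b * x) * ZMod.stdAddChar (N := p) (y * (c + k * x ^ 2)) := by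
      intro y
      rw [← AddChar.map_add_eq_mul]; congr 1; ring
    simp_rw [this]
    rw [← Finset.mul_sum, AddChar.sum_mulShift _ (ZMod.isPrimitive_stdAddChar p), norm_mul,
      AddChar.norm_apply, ZMod.card]
    split_ifs <;> simp
  refine (norm_sum_le _ _).trans ?_
  simp_rw [h1]
  rw [← Finset.sum_filter, Finset.sum_const, nsmul_eq_mul]
  gcongr
  have : (Finset.univ.filter fun x : ZMod p => c + k * x ^ 2 = 0).card ≤ 2 := by
    by_cases hE : ∃ x₀ : ZMod p, c + k * x₀ ^ 2 = 0
    · obtain ⟨x₀, hx₀⟩ := hE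
      refine (Finset.card_le_card (t := {x₀, -x₀}) ?_).trans Finset.card_le_two
      intro x hx
      simp only [Finset.mem_filter, Finset.mem_univ, true_and] at hx
      have : k * (x ^ 2 - x₀ ^ 2) = 0 := by linear_combination hx - hx₀
      have := (mul_eq_zero.mp this).resolve_left hk
      simpa using sq_eq_sq_iff_eq_or_eq_neg.mp (sub_eq_zero.mp this)
    · push Not at hE
      simp [hE]
  exact_mod_cast this

theorem statement18 (p : ℕ) [hp : Fact p.Prime] (hodd : Odd p) (q m₂ : ℤ)
    (hm₂ : m₂ ≠ 0) (hpm : ¬ (p : ℤ) ∣ m₂ * q) (b c : ℤ) :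
    S1 p q m₂ b c 0 = 0 ∧
    ∀ d : ℤ, ‖S1 p q m₂ b c d‖ ≤ 2 * (p : ℝ) ^ ((3 : ℝ)/2) := by
  have hp2 : p ≠ 2 := by rintro rfl; exact absurd hodd (by decide)
  rw [← ZMod.intCast_zmod_eq_zero_iff_dvd] at hpm
  push_cast at hpm
  obtain ⟨hm, hq⟩ := mul_ne_zero_iff.mp hpm
  have key : ∀ d : ℤ, S1 p q m₂ b c d =
      (∑ x : ZMod p, ∑ y : ZMod p, ZMod.stdAddChar (N := p)
        ((b : ZMod p) * x + c * y + (d * (q : ZMod p)⁻¹ * m₂) * x ^ 2 * y)) *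
      gaussSum (auxChi p)
        (AddChar.mulShift (ZMod.stdAddChar (N := p)) (-((d : ZMod p) * (q : ZMod p)⁻¹))) := by
    intro d
    rw [aux_S1, Finset.sum_mul]
    refine Finset.sum_congr rfl fun x _ => ?_
    rw [Finset.sum_mul]
    refine Finset.sum_congr rfl fun y _ => ?_
    have := aux_inner p q d (m₂ * x ^ 2 * y) hq
    rw [AddChar.map_add_eq_mul,
      show (d * (q : ZMod p)⁻¹ * m₂) * x ^ 2 * y = d * (q : ZMod p)⁻¹ * (m₂ * x ^ 2 * y) by ring,
      mul_assoc (ZMod.stdAddChar (N := p) _), ← this, Finset.mul_sum]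
    refine Finset.sum_congr rfl fun z _ => ?_
    rw [AddChar.map_add_eq_mul]; ring
  have hzero : ∀ d : ℤ, (d : ZMod p) = 0 → S1 p q m₂ b c d = 0 := by
    intro d hd
    rw [key, hd, zero_mul, neg_zero, aux_gauss_zero p hp2, mul_zero]
  refine ⟨hzero 0 (by simp), fun d => ?_⟩
  by_cases hd : (d : ZMod p) = 0
  · rw [hzero d hd, norm_zero]; positivity
  · have hdq : (d : ZMod p) * (q : ZMod p)⁻¹ ≠ 0 := mul_ne_zero hd (inv_ne_zero hq)
    have hg := aux_gauss_norm p hp2 _ (neg_ne_zero.mpr hdq)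
    have hg' := (Real.sqrt_eq_iff_eq_sq (Nat.cast_nonneg p) (norm_nonneg _)).mpr hg.symm
    have hpp : (0 : ℝ) < p := by exact_mod_cast hp.out.pos
    rw [key, norm_mul, ← hg', show (3 : ℝ) / 2 = 1 + 1 / 2 by norm_num, Real.rpow_add hpp,
      Real.rpow_one, ← Real.sqrt_eq_rpow, ← mul_assoc]
    gcongr
    exact aux_double p hp2 _ _ _ (mul_ne_zero hdq hm)
end
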